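/- arXiv:gr-qc/9308028 — 3 statements merged into one kernel-verified Lean document; each statement's English description precedes it below -/
import Mathlib

section
/- Let R be a reduced crystallographic root system in a finite-dimensional real inner product space E, let S be a base of R, and let H lie in the open fundamental Weyl chamber K(S). Set S(H) = {α ∈ R : ⟨α, H⟩ = 2}. Then for all α, β ∈ S(H) with α ≠ β, one has ⟨α, β⟩ ≤ 0. -/
open scoped RealInnerProductSpace

/-- A reduced crystallographic root system in a real inner product space `E`:
a finite set of nonzero vectors, with integral Cartan numbers, closed under the
reflections it defines, and such that the only multiples of a root `α` that are
roots are `±α`. -/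
def IsRootSystem {E : Type*} [NormedAddCommGroup E] [InnerProductSpace ℝ E]
    (R : Set E) : Prop :=
  R.Finite ∧ (0 : E) ∉ R ∧
  (∀ α ∈ R, ∀ β ∈ R, ∃ n : ℤ, 2 * ⟪β, α⟫ / ⟪α, α⟫ = (n : ℝ)) ∧
  (∀ α ∈ R, ∀ β ∈ R, β - (2 * ⟪β, α⟫ / ⟪α, α⟫) • α ∈ R) ∧
  (∀ α ∈ R, ∀ t : ℝ, t • α ∈ R → t = 1 ∨ t = -1)

/-- `S` is a base (simple system) of the root system `R`: a linearly independent
subset such that every root is an integer linear combination of elements of `S`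
with coefficients all nonnegative or all nonpositive. -/
def IsBase {E : Type*} [NormedAddCommGroup E] [InnerProductSpace ℝ E]
    (R S : Set E) : Prop :=
  S ⊆ R ∧ LinearIndependent ℝ ((↑) : S → E) ∧
  ∀ β ∈ R, ∃ c : E →₀ ℤ, ↑c.support ⊆ S ∧
    β = c.sum (fun α n => (n : ℝ) • α) ∧
    ((∀ α, 0 ≤ c α) ∨ (∀ α, c α ≤ 0))


/-- For `H` in the open fundamental Weyl chamber and distinct `α, β` in
`S(H) = {α ∈ R : ⟪α,H⟫ = 2}`, one has `⟪α, β⟫ ≤ 0`. -/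
theorem inner_nonpos_of_mem_SH
    {E : Type*} [NormedAddCommGroup E] [InnerProductSpace ℝ E] [FiniteDimensional ℝ E]
    (R S : Set E) (hR : IsRootSystem R) (hS : IsBase R S)
    (H : E) (hH : ∀ α ∈ S, 0 < ⟪α, H⟫)
    (α β : E) (hα : α ∈ R) (hβ : β ∈ R)
    (hα2 : ⟪α, H⟫ = 2) (hβ2 : ⟪β, H⟫ = 2) (hne : α ≠ β) :
    ⟪α, β⟫ ≤ 0 := by
  obtain ⟨-, h0, hcartan, hrefl, -⟩ := hR
  obtain ⟨-, -, hdec⟩ := hS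
  -- no root is orthogonal to `H`
  have key : ∀ γ ∈ R, ⟪γ, H⟫ ≠ 0 := by
    intro γ hγ hz
    obtain ⟨c, hc, hsum, hsign⟩ := hdec γ hγ
    have hz' : ∑ a ∈ c.support, (c a : ℝ) * ⟪a, H⟫ = 0 := by
      rw [hsum, Finsupp.sum, sum_inner] at hz
      simpa [real_inner_smul_left] using hz
    have hall : ∀ a ∈ c.support, (c a : ℝ) * ⟪a, H⟫ = 0 := by
      rcases hsign with h | h
      · refine (Finset.sum_eq_zero_iff_of_nonneg ?_).1 hz'
        intro a ha
        exact mul_nonneg (by exact_mod_cast h a) (hH a (hc ha)).le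
      · refine (Finset.sum_eq_zero_iff_of_nonpos ?_).1 hz'
        intro a ha
        exact mul_nonpos_of_nonpos_of_nonneg (by exact_mod_cast h a) (hH a (hc ha)).le
    apply h0
    have : γ = 0 := by
      rw [hsum, Finsupp.sum]
      refine Finset.sum_eq_zero fun a ha => ?_
      rcases mul_eq_zero.1 (hall a ha) with h | h
      · rw [h, zero_smul]
      · exact absurd h (hH a (hc ha)).ne'
    exact this ▸ hγ
  by_contra! hpos
  have ha : 0 < ⟪α, α⟫ := real_inner_self_pos.2 (fun h => h0 (h ▸ hα))
  have hb : 0 < ⟪β, β⟫ := real_inner_self_pos.2 (fun h => h0 (h ▸ hβ))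
  -- strict Cauchy-Schwarz
  have hcs : ⟪α, β⟫ * ⟪α, β⟫ < ⟪α, α⟫ * ⟪β, β⟫ := by
    by_contra! hle
    have hv : ⟪⟪β, β⟫ • α - ⟪α, β⟫ • β, ⟪β, β⟫ • α - ⟪α, β⟫ • β⟫
        = ⟪β, β⟫ * (⟪α, α⟫ * ⟪β, β⟫ - ⟪α, β⟫ * ⟪α, β⟫) := by
      simp only [inner_sub_left, inner_sub_right, real_inner_smul_left, real_inner_smul_right,
        real_inner_comm α β]
      ring
    have hv0 : ⟪β, β⟫ • α - ⟪α, β⟫ • β = 0 := by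
      rw [← real_inner_self_nonpos, hv]
      exact mul_nonpos_of_nonneg_of_nonpos hb.le (by linarith)
    have hvH : ⟪⟪β, β⟫ • α - ⟪α, β⟫ • β, H⟫ = 0 := by rw [hv0, inner_zero_left]
    rw [inner_sub_left, real_inner_smul_left, real_inner_smul_left, hα2, hβ2] at hvH
    have hx : ⟪α, β⟫ = ⟪β, β⟫ := by linarith
    rw [hx, ← smul_sub] at hv0
    rcases smul_eq_zero.1 hv0 with h | h
    · exact hb.ne' h
    · exact hne (sub_eq_zero.1 h)
  obtain ⟨m, hm⟩ := hcartan α hα β hβ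
  obtain ⟨n, hn⟩ := hcartan β hβ α hα
  have r1 := hrefl α hα β hβ
  have r2 := hrefl β hβ α hα
  rw [hm] at r1
  rw [hn] at r2
  have k1 := key _ r1
  have k2 := key _ r2
  rw [inner_sub_left, real_inner_smul_left, hα2, hβ2] at k1 k2
  have m1 : m ≠ 1 := by rintro rfl; norm_num at k1
  have n1 : n ≠ 1 := by rintro rfl; norm_num at k2
  have hm' : 2 * ⟪α, β⟫ = m * ⟪α, α⟫ := by
    rw [← hm, real_inner_comm α β]; field_simp
  have hn' : 2 * ⟪α, β⟫ = n * ⟪β, β⟫ := by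
    rw [← hn]; field_simp
  have m0 : (0 : ℝ) < m := by
    by_contra! h
    nlinarith
  have n0 : (0 : ℝ) < n := by
    by_contra! h
    nlinarith
  have m0' : 0 < m := by exact_mod_cast m0
  have n0' : 0 < n := by exact_mod_cast n0
  have m2 : (2 : ℝ) ≤ m := by exact_mod_cast (by omega : (2 : ℤ) ≤ m)
  have n2 : (2 : ℝ) ≤ n := by exact_mod_cast (by omega : (2 : ℤ) ≤ n)
  have e1 : ⟪α, α⟫ ≤ ⟪α, β⟫ := by nlinarith
  have e2 : ⟪β, β⟫ ≤ ⟪α, β⟫ := by nlinarith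
  have := mul_le_mul e1 e2 hb.le hpos.le
  linarith
end

section
/- Let L be a finite-dimensional complex semisimple Lie algebra with Cartan subalgebra h and root system Φ ⊆ h*, and let Σ ⊆ Φ be a Π-system: a linearly independent subset such that α − β ∉ Φ for all α, β ∈ Σ. Let R(Σ) be the root subsystem with base Σ and R(Σ)₊ its positive roots, and set H = Σ_{β ∈ R(Σ)₊} β∨ ∈ h (sum of the positive coroots of R(Σ)). Then H is an A₁-vector: there exist E₊ ∈ ⨁_{α ∈ Σ} L_α and E₋ ∈ ⨁_{α ∈ Σ} L_{−α} such that ⁅H, E₊⁆ = 2E₊, ⁅H, E₋⁆ = −2E₋, and ⁅E₊, E₋⁆ = H. -/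
/-- The root space `L_α = {X ∈ L : ⁅H, X⁆ = α(H)·X for all H ∈ h}` attached to a
linear functional `α` on a Lie subalgebra `h` of `L`. -/
noncomputable def rootSpace' {L : Type*} [LieRing L] [LieAlgebra ℂ L]
    (h : LieSubalgebra ℂ L) (α : Module.Dual ℂ ↥h) : Submodule ℂ L where
  carrier := {X | ∀ H : ↥h, ⁅(H : L), X⁆ = α H • X}
  add_mem' := by
    intro a b ha hb H
    rw [lie_add, ha H, hb H, smul_add]
  zero_mem' := by
    intro H
    simp
  smul_mem' := by
    intro c x hx H
    rw [lie_smul, hx H, smul_comm]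
/-- The reflection `s_β : γ ↦ γ − γ(β∨)·β` on linear functionals on `h`, defined
using a coroot assignment `cor` (`β∨ = cor β`), as a self-map of the dual. -/
noncomputable def sDual {L : Type*} [LieRing L] [LieAlgebra ℂ L]
    {h : LieSubalgebra ℂ L} (cor : Module.Dual ℂ ↥h → ↥h)
    (β : Module.Dual ℂ ↥h) : Function.End (Module.Dual ℂ ↥h) :=
  fun γ => γ - γ (cor β) • β

/-- The set of all images of elements of `Sg` under the group generated by the
reflections `s_β`, `β ∈ Sg` (equivalently, the generated monoid of self-maps,
since each reflection is an involution): the root subsystem with base `Sg`. -/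
noncomputable def dualSubSystem {L : Type*} [LieRing L] [LieAlgebra ℂ L]
    {h : LieSubalgebra ℂ L} (cor : Module.Dual ℂ ↥h → ↥h)
    (Sg : Set (Module.Dual ℂ ↥h)) : Set (Module.Dual ℂ ↥h) :=
  {x | ∃ w ∈ Submonoid.closure (sDual cor '' Sg), ∃ α ∈ Sg, x = w α}

/-- `β` is an integer linear combination of elements of `Sg` with all
coefficients nonnegative. -/
def DualNonnegCombo {L : Type*} [LieRing L] [LieAlgebra ℂ L]
    {h : LieSubalgebra ℂ L} (Sg : Set (Module.Dual ℂ ↥h))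
    (β : Module.Dual ℂ ↥h) : Prop :=
  ∃ c : Module.Dual ℂ ↥h →₀ ℤ, ↑c.support ⊆ Sg ∧
    β = c.sum (fun α n => n • α) ∧ ∀ α, 0 ≤ c α

/-- `S` is a base of the root system `Φ`: every root is an integer linear
combination of elements of `S` with coefficients all nonnegative or all
nonpositive. -/
def DualIsBase {L : Type*} [LieRing L] [LieAlgebra ℂ L]
    {h : LieSubalgebra ℂ L} (Φ S : Set (Module.Dual ℂ ↥h)) : Prop :=
  S ⊆ Φ ∧ ∀ β ∈ Φ, ∃ c : Module.Dual ℂ ↥h →₀ ℤ, ↑c.support ⊆ S ∧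
    β = c.sum (fun α n => n • α) ∧ ((∀ α, 0 ≤ c α) ∨ (∀ α, c α ≤ 0))

structure AbsRoots {N : Type*} [AddCommGroup N] [Module ℂ N]
    (Φ : Set (Module.Dual ℂ N)) (cor : Module.Dual ℂ N → N) : Prop where
  ne_zero : ∀ α ∈ Φ, α ≠ 0
  two : ∀ α ∈ Φ, α (cor α) = 2
  int : ∀ α ∈ Φ, ∀ β ∈ Φ, ∃ n : ℤ, α (cor β) = n
  sub_mem : ∀ α ∈ Φ, ∀ β ∈ Φ, α ≠ β → ∀ n : ℤ, 0 < n → α (cor β) = n → α - β ∈ Φ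
  pos_symm : ∀ α ∈ Φ, ∀ β ∈ Φ, ∀ n m : ℤ, α (cor β) = n → β (cor α) = m → 0 < n → 0 < m
  refl_mem : ∀ α ∈ Φ, ∀ β ∈ Φ, α - α (cor β) • β ∈ Φ
  cor_refl : ∀ α ∈ Φ, ∀ β ∈ Φ, cor (α - α (cor β) • β) = cor α - β (cor α) • cor β
  reduced : ∀ α ∈ Φ, ∀ k : ℤ, k • α ∈ Φ → k = 1 ∨ k = -1

section Abs
variable {N : Type*} [AddCommGroup N] [Module ℂ N]

/-- integer linear combination -/
noncomputable def lc : (Module.Dual ℂ N →₀ ℤ) →ₗ[ℤ] Module.Dual ℂ N :=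
  Finsupp.linearCombination ℤ id

lemma lc_single (σ : Module.Dual ℂ N) (n : ℤ) : lc (Finsupp.single σ n) = n • σ := by
  simp [lc]

lemma lc_apply (c : Module.Dual ℂ N →₀ ℤ) (x : N) :
    lc c x = ∑ σ ∈ c.support, (c σ : ℂ) * σ x := by
  simp [lc, Finsupp.linearCombination_apply, Finsupp.sum]

lemma lc_inj {Sg : Set (Module.Dual ℂ N)}
    (hli : LinearIndependent ℂ ((↑) : Sg → Module.Dual ℂ N))
    {c d : Module.Dual ℂ N →₀ ℤ} (hc : c ∈ Finsupp.supported ℤ ℤ Sg)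
    (hd : d ∈ Finsupp.supported ℤ ℤ Sg) (h : lc c = lc d) : c = d := by
  have h1 : LinearIndependent ℤ ((↑) : Sg → Module.Dual ℂ N) :=
    hli.restrict_scalars (by
      intro a b hab
      simpa using hab)
  have h2 : LinearIndepOn ℤ id Sg := h1
  rw [linearIndepOn_iff] at h2
  have := h2 (c - d) (Submodule.sub_mem _ hc hd) (by
    have : lc (c - d) = 0 := by rw [map_sub, h, sub_self]
    exact this)
  exact sub_eq_zero.mp this

/-- size -/
noncomputable def sz (c : Module.Dual ℂ N →₀ ℤ) : ℕ := ∑ σ ∈ c.support, (c σ).natAbs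

lemma sz_lt {c d : Module.Dual ℂ N →₀ ℤ} (σ : Module.Dual ℂ N)
    (hσ : (d σ).natAbs < (c σ).natAbs) (h : ∀ τ, τ ≠ σ → d τ = c τ) : sz d < sz c := by
  have hs : d.support ⊆ c.support := by
    intro τ hτ
    simp only [Finsupp.mem_support_iff] at hτ ⊢
    by_cases e : τ = σ
    · subst e; intro h0; simp [h0] at hσ
    · rwa [← h τ e]
  have : sz d = ∑ σ ∈ c.support, (d σ).natAbs := by
    apply Finset.sum_subset hs
    intro x _ hx
    simpa using hx
  rw [this]
  apply Finset.sum_lt_sum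
  · intro τ _
    by_cases e : τ = σ
    · subst e; exact hσ.le
    · rw [h τ e]
  · refine ⟨σ, ?_, hσ⟩
    simp only [Finsupp.mem_support_iff]
    intro h0; simp [h0] at hσ

lemma sz_neg (c : Module.Dual ℂ N →₀ ℤ) : sz (-c) = sz c := by
  simp [sz]

variable {Φ : Set (Module.Dual ℂ N)} {cor : Module.Dual ℂ N → N}

lemma AbsRoots.cor_neg (R : AbsRoots Φ cor) {α} (h : α ∈ Φ) : cor (-α) = -cor α := by
  have := R.cor_refl α h α h
  rw [R.two α h] at this
  rw [show α - (2:ℂ) • α = -α by module] at this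
  rw [this]; module

lemma AbsRoots.neg_mem (R : AbsRoots Φ cor) {α} (h : α ∈ Φ) : -α ∈ Φ := by
  have := R.refl_mem α h α h
  rw [R.two α h] at this
  rwa [show α - (2:ℂ) • α = -α by module] at this

lemma AbsRoots.exists_pos (R : AbsRoots Φ cor) {Sg : Set (Module.Dual ℂ N)} (hS : Sg ⊆ Φ)
    {c : Module.Dual ℂ N →₀ ℤ} (hc : c ∈ Finsupp.supported ℤ ℤ Sg) (hΦ : lc c ∈ Φ) :
    ∃ σ ∈ Sg, ∃ n : ℤ, σ (cor (lc c)) = n ∧ 0 < c σ * n := by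
  classical
  by_contra! hcon
  have h1 : ∀ σ : Module.Dual ℂ N, ∃ n : ℤ, σ ∈ Sg → σ (cor (lc c)) = n := by
    intro σ
    by_cases h : σ ∈ Sg
    · obtain ⟨n, hn⟩ := R.int σ (hS h) _ hΦ
      exact ⟨n, fun _ => hn⟩
    · exact ⟨0, fun h' => absurd h' h⟩
  choose n hn using h1
  have h2 := R.two _ hΦ
  rw [lc_apply] at h2
  have h3 : ∑ σ ∈ c.support, (c σ : ℂ) * σ (cor (lc c)) =
      ((∑ σ ∈ c.support, c σ * n σ : ℤ) : ℂ) := by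
    push_cast
    apply Finset.sum_congr rfl
    intro σ hσ
    rw [hn σ (hc hσ)]
  rw [h3] at h2
  have h4 : (∑ σ ∈ c.support, c σ * n σ : ℤ) = 2 := by exact_mod_cast h2
  have h5 : (∑ σ ∈ c.support, c σ * n σ : ℤ) ≤ 0 :=
    Finset.sum_nonpos fun σ hσ => hcon σ (hc hσ) _ (hn σ (hc hσ))
  omega

lemma AbsRoots.step (R : AbsRoots Φ cor) {Sg : Set (Module.Dual ℂ N)} (hS : Sg ⊆ Φ)
    (hli : LinearIndependent ℂ ((↑) : Sg → Module.Dual ℂ N))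
    (hpi : ∀ α ∈ Sg, ∀ β ∈ Sg, α - β ∉ Φ)
    {c : Module.Dual ℂ N →₀ ℤ} (hc : c ∈ Finsupp.supported ℤ ℤ Sg) (hΦ : lc c ∈ Φ)
    (IH : ∀ d ∈ Finsupp.supported ℤ ℤ Sg, lc d ∈ Φ → sz d < sz c →
      (∀ τ, 0 ≤ d τ) ∨ (∀ τ, d τ ≤ 0))
    {σ : Module.Dual ℂ N} (hσ : σ ∈ Sg) {n : ℤ} (hn : σ (cor (lc c)) = n) (hn0 : 0 < n)
    (hcσ : 0 < c σ) : (∀ τ, 0 ≤ c τ) ∨ (∀ τ, c τ ≤ 0) := by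
  classical
  have hsg : ∀ τ ∈ Sg, ∀ k : ℤ, Finsupp.single τ k ∈ Finsupp.supported ℤ ℤ Sg :=
    fun τ hτ k => Finsupp.single_mem_supported ℤ k hτ
  by_cases hβ : σ = lc c
  · have : c = Finsupp.single σ 1 := lc_inj hli hc (hsg σ hσ 1) (by rw [lc_single, ← hβ]; simp)
    left; intro τ; rw [this, Finsupp.single_apply]; split_ifs <;> simp
  have hγ : σ - lc c ∈ Φ := R.sub_mem σ (hS hσ) _ hΦ hβ n hn0 hn
  have hγ' : lc (c - Finsupp.single σ 1) ∈ Φ := by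
    have := R.neg_mem hγ
    rw [neg_sub] at this
    rwa [map_sub, lc_single, one_smul]
  rcases IH _ (Submodule.sub_mem _ hc (hsg σ hσ 1)) hγ' (sz_lt σ (by simp; omega)
    (fun τ hτ => by simp [Finsupp.single_apply, Ne.symm hτ])) with h | h
  · left
    intro τ
    have := h τ
    rw [Finsupp.sub_apply, Finsupp.single_apply] at this
    split_ifs at this <;> omega
  have hcσ1 : c σ = 1 := by
    have := h σ
    simp at this; omega
  have hcne : ∀ τ, τ ≠ σ → c τ ≤ 0 := by
    intro τ hτ
    have := h τ
    simpa [Finsupp.single_apply, Ne.symm hτ] using this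
  have hd : (Finsupp.single σ 1 - c) ∈ Finsupp.supported ℤ ℤ Sg :=
    Submodule.sub_mem _ (hsg σ hσ 1) hc
  have hld : lc (Finsupp.single σ 1 - c) = σ - lc c := by
    rw [map_sub, lc_single, one_smul]
  obtain ⟨τ, hτ, m, hm, hm0⟩ := R.exists_pos hS hd (by rwa [hld])
  rw [hld] at hm
  have hτσ : τ ≠ σ := by
    rintro rfl
    simp [hcσ1] at hm0
  have hcτ : c τ < 0 := by
    have h1 := hcne τ hτσ
    rcases h1.lt_or_eq with h1 | h1
    · exact h1
    · simp [Finsupp.single_apply, Ne.symm hτσ, h1] at hm0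
  have hmpos : 0 < m := by
    simp only [Finsupp.sub_apply, Finsupp.single_apply, Ne.symm hτσ, if_false, zero_sub] at hm0
    exact pos_of_mul_pos_right hm0 (by omega)
  obtain ⟨k, hk⟩ := R.int _ hγ τ (hS hτ)
  have hk0 : 0 < k := R.pos_symm τ (hS hτ) _ hγ m k hm hk hmpos
  obtain ⟨l, hl⟩ := R.int σ (hS hσ) τ (hS hτ)
  have hl0 : l ≤ 0 := by
    by_contra! hl0
    exact hpi σ hσ τ hτ (R.sub_mem σ (hS hσ) τ (hS hτ) (Ne.symm hτσ) l hl0 hl)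
  have hβτ : (-lc c) (cor τ) = ((k - l : ℤ) : ℂ) := by
    push_cast
    rw [← hk, ← hl]; simp
  have hne : -lc c ≠ τ := by
    intro e
    have : c = Finsupp.single τ (-1) := lc_inj hli hc (hsg τ hτ _) (by
      rw [lc_single, ← e]; simp)
    rw [this] at hcσ
    simp [Finsupp.single_apply, hτσ] at hcσ
  have h3 := R.neg_mem (R.sub_mem _ (R.neg_mem hΦ) τ (hS hτ) hne (k - l) (by omega) hβτ)
  have h4 : lc (c + Finsupp.single τ 1) ∈ Φ := by
    rw [map_add, lc_single, one_smul]
    rwa [show -(-lc c - τ) = lc c + τ by abel] at h3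
  exfalso
  rcases IH _ (Submodule.add_mem _ hc (hsg τ hτ 1)) h4 (sz_lt τ (by simp; omega)
    (fun τ' hτ' => by simp [Finsupp.single_apply, Ne.symm hτ'])) with h | h
  · have : c = Finsupp.single σ 1 - Finsupp.single τ 1 := by
      ext ρ
      have h5 := h ρ
      have h6 := hcne ρ
      simp only [Finsupp.add_apply, Finsupp.sub_apply, Finsupp.single_apply] at h5 ⊢
      by_cases e1 : σ = ρ
      · subst e1; simp [hτσ, hcσ1]
      · have h6 := h6 (Ne.symm e1)
        by_cases e2 : τ = ρ
        · subst e2; simp [e1] at h5 ⊢; omega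
        · simp [e1, e2] at h5 ⊢; omega
    apply hpi σ hσ τ hτ
    rw [this, map_sub, lc_single, lc_single, one_smul, one_smul] at hΦ
    exact hΦ
  · have := h σ
    simp [Finsupp.single_apply, hτσ, hcσ1] at this

lemma AbsRoots.same_sign (R : AbsRoots Φ cor) {Sg : Set (Module.Dual ℂ N)} (hS : Sg ⊆ Φ)
    (hli : LinearIndependent ℂ ((↑) : Sg → Module.Dual ℂ N))
    (hpi : ∀ α ∈ Sg, ∀ β ∈ Sg, α - β ∉ Φ) (k : ℕ) :
    ∀ c ∈ Finsupp.supported ℤ ℤ Sg, lc c ∈ Φ → sz c = k →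
      (∀ τ, 0 ≤ c τ) ∨ (∀ τ, c τ ≤ 0) := by
  induction k using Nat.strong_induction_on with
  | _ k ih =>
  intro c hc hΦ hk
  have IH : ∀ d ∈ Finsupp.supported ℤ ℤ Sg, lc d ∈ Φ → sz d < sz c →
      (∀ τ, 0 ≤ d τ) ∨ (∀ τ, d τ ≤ 0) := fun d hd hdΦ hlt => ih _ (hk ▸ hlt) d hd hdΦ rfl
  obtain ⟨σ, hσ, n, hn, hpos⟩ := R.exists_pos hS hc hΦ
  rcases lt_trichotomy (c σ) 0 with h0 | h0 | h0
  · have := R.step (c := -c) hS hli hpi (Submodule.neg_mem _ hc) (by rw [map_neg]; exact R.neg_mem hΦ)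
      (by rwa [sz_neg]) hσ (n := -n) (by rw [map_neg, R.cor_neg hΦ, map_neg, hn]; simp)
      (by nlinarith) (by simpa using h0)
    simpa using this.symm
  · simp [h0] at hpos
  · exact R.step hS hli hpi hc hΦ IH hσ hn (pos_of_mul_pos_right hpos h0.le) h0

lemma AbsRoots.simple_pairing (R : AbsRoots Φ cor) {Sg : Set (Module.Dual ℂ N)} (hS : Sg ⊆ Φ)
    (hli : LinearIndependent ℂ ((↑) : Sg → Module.Dual ℂ N))
    (hpi : ∀ α ∈ Sg, ∀ β ∈ Sg, α - β ∉ Φ) (P : Finset (Module.Dual ℂ N))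
    (D : Set (Module.Dual ℂ N)) (hDΦ : D ⊆ Φ) (hSD : Sg ⊆ D)
    (hDr : ∀ β ∈ D, ∀ α ∈ Sg, β - β (cor α) • α ∈ D)
    (hP : ∀ β, β ∈ P ↔ β ∈ D ∧ ∃ c ∈ Finsupp.supported ℤ ℤ Sg, β = lc c ∧ ∀ τ, 0 ≤ c τ)
    {α : Module.Dual ℂ N} (hα : α ∈ Sg) : α (∑ β ∈ P, cor β) = 2 := by
  classical
  have hsg : ∀ k : ℤ, Finsupp.single α k ∈ Finsupp.supported ℤ ℤ Sg :=
    fun k => Finsupp.single_mem_supported ℤ k hα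
  have hαΦ := hS hα
  have hαP : α ∈ P := (hP α).2 ⟨hSD hα, Finsupp.single α 1, hsg 1, by simp [lc_single], fun τ => by
    rw [Finsupp.single_apply]; split_ifs <;> simp⟩
  rw [← Finset.add_sum_erase P cor hαP, map_add, R.two α hαΦ, map_sum]
  have hsum : ∑ β ∈ P.erase α, α (cor β) = 0 := by
    have hmem : ∀ β ∈ P.erase α, β ∈ Φ := fun β hβ =>
      hDΦ ((hP β).1 (Finset.mem_of_mem_erase hβ)).1
    have hval : ∀ β ∈ P.erase α, α (cor (β - β (cor α) • α)) = - α (cor β) := by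
      intro β hβ
      rw [R.cor_refl β (hmem β hβ) α hαΦ, map_sub, map_smul, R.two α hαΦ, smul_eq_mul]; ring
    refine Finset.sum_involution (fun β _ => β - β (cor α) • α) ?_ ?_ ?_ ?_
    · intro β hβ
      rw [hval β hβ]; ring
    · intro β hβ h0 e
      have := hval β hβ
      rw [e] at this
      apply h0
      linear_combination this / 2
    · intro β hβ
      have hβα : β ≠ α := Finset.ne_of_mem_erase hβ
      obtain ⟨hβD, c, hc, rfl, hc0⟩ := (hP β).1 (Finset.mem_of_mem_erase hβ)
      have hβΦ := hDΦ hβD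
      obtain ⟨n, hn⟩ := R.int _ hβΦ α hαΦ
      have hex : ∃ τ, τ ≠ α ∧ 0 < c τ := by
        by_contra! hcon
        have hcs : c = Finsupp.single α (c α) := by
          ext τ
          by_cases e : α = τ
          · subst e; simp
          · simp [Finsupp.single_apply, e]
            exact le_antisymm (hcon τ (Ne.symm e)) (hc0 τ)
        rw [hcs, lc_single] at hβΦ hβα
        have := hc0 α
        rcases R.reduced α hαΦ _ hβΦ with h | h
        · rw [h] at hβα; simp at hβα
        · omega
      obtain ⟨τ, hτ, hcτ⟩ := hex
      have hlc : lc c - (lc c) (cor α) • α = lc (c - Finsupp.single α n) := by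
        rw [map_sub, lc_single, hn, Int.cast_smul_eq_zsmul]
      have hsup := Submodule.sub_mem _ hc (hsg n)
      have hval : ∀ τ, τ ≠ α → (c - Finsupp.single α n) τ = c τ := by
        intro τ hτ; simp [Finsupp.single_apply, Ne.symm hτ]
      have hD' := hDr _ hβD α hα
      rw [hlc] at hD' ⊢
      refine Finset.mem_erase.2 ⟨?_, (hP _).2 ⟨hD', _, hsup, rfl, ?_⟩⟩
      · intro e
        have := lc_inj hli hsup (hsg 1) (by rw [e, lc_single]; simp)
        have h1 := hval τ hτ
        rw [this] at h1
        simp [Finsupp.single_apply, Ne.symm hτ] at h1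
        omega
      · refine (R.same_sign hS hli hpi _ _ hsup (hDΦ hD') rfl).resolve_right ?_
        intro h
        have := h τ
        rw [hval τ hτ] at this
        omega
    · intro β hβ
      simp only [LinearMap.sub_apply, LinearMap.smul_apply, R.two α hαΦ, smul_eq_mul]
      module
  rw [hsum, add_zero]

end Abs

/-- abstract facts from a Mathlib root system -/
lemma absRoots_of_rootPairing {N ι : Type*} [AddCommGroup N] [Module ℂ N] [Finite ι]
    (P : RootPairing ι ℂ (Module.Dual ℂ N) N) [P.IsCrystallographic] [P.IsReduced]
    (hid : ∀ f x, P.toLinearMap f x = f x)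
    (Φ : Set (Module.Dual ℂ N)) (cor : Module.Dual ℂ N → N)
    (h1 : ∀ α, α ∈ Φ ↔ ∃ i, P.root i = α) (h2 : ∀ i, cor (P.root i) = P.coroot i) :
    AbsRoots Φ cor := by
  have hp : ∀ i j, (P.root i) (cor (P.root j)) = ((P.pairingIn ℤ i j : ℤ) : ℂ) := by
    intro i j
    rw [h2, ← hid, P.root_coroot_eq_pairing]
    exact (P.algebraMap_pairingIn ℤ i j).symm
  have hr : ∀ i j, P.root i - (P.root i) (cor (P.root j)) • P.root j
      = P.root (P.reflectionPerm j i) := by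
    intro i j
    rw [P.root_reflectionPerm, P.reflection_apply_root, h2, ← hid, P.root_coroot_eq_pairing]
  refine ⟨?_, ?_, ?_, ?_, ?_, ?_, ?_, ?_⟩
  · intro α hα
    obtain ⟨i, rfl⟩ := (h1 _).1 hα
    exact P.ne_zero i
  · intro α hα
    obtain ⟨i, rfl⟩ := (h1 _).1 hα
    rw [hp]; simp
  · intro α hα β hβ
    obtain ⟨i, rfl⟩ := (h1 _).1 hα
    obtain ⟨j, rfl⟩ := (h1 _).1 hβ
    exact ⟨_, hp i j⟩
  · intro α hα β hβ hne n hn0 hn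
    obtain ⟨i, rfl⟩ := (h1 _).1 hα
    obtain ⟨j, rfl⟩ := (h1 _).1 hβ
    rw [hp] at hn
    have hn : P.pairingIn ℤ i j = n := by exact_mod_cast hn
    have := P.root_sub_root_mem_of_pairingIn_pos (i := i) (j := j) (by omega)
      (fun e => hne (by rw [e]))
    obtain ⟨k, hk⟩ := this
    exact (h1 _).2 ⟨k, hk⟩
  · intro α hα β hβ n m hn hm hn0
    obtain ⟨i, rfl⟩ := (h1 _).1 hα
    obtain ⟨j, rfl⟩ := (h1 _).1 hβ
    rw [hp] at hn hm
    have hn : P.pairingIn ℤ i j = n := by exact_mod_cast hn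
    have hm : P.pairingIn ℤ j i = m := by exact_mod_cast hm
    rw [← hm, P.zero_lt_pairingIn_iff', hn]
    exact hn0
  · intro α hα β hβ
    obtain ⟨i, rfl⟩ := (h1 _).1 hα
    obtain ⟨j, rfl⟩ := (h1 _).1 hβ
    rw [hr]
    exact (h1 _).2 ⟨_, rfl⟩
  · intro α hα β hβ
    obtain ⟨i, rfl⟩ := (h1 _).1 hα
    obtain ⟨j, rfl⟩ := (h1 _).1 hβ
    rw [hr, h2, P.coroot_reflectionPerm, P.coreflection_apply_coroot, h2, h2, ← hid,
      P.root_coroot_eq_pairing]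
  · intro α hα k hk
    obtain ⟨i, rfl⟩ := (h1 _).1 hα
    obtain ⟨j, hj⟩ := (h1 _).1 hk
    have hdep : ¬ LinearIndependent ℂ ![P.root i, P.root j] := by
      rw [LinearIndependent.pair_iff]
      push Not
      refine ⟨(k : ℂ), -1, ?_, by simp⟩
      rw [hj, Int.cast_smul_eq_zsmul]; module
    have h0 := P.ne_zero i
    have key : ∀ m : ℤ, k • P.root i = m • P.root i → k = m := by
      intro m hm
      rw [← Int.cast_smul_eq_zsmul ℂ, ← Int.cast_smul_eq_zsmul ℂ] at hm
      exact_mod_cast smul_left_injective ℂ h0 hm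
    rcases RootPairing.IsReduced.eq_or_eq_neg i j hdep with h | h
    · left; apply key; rw [← hj, ← h]; simp
    · right; apply key; rw [← hj, h]; simp

lemma rootSpace'_eq {L : Type*} [LieRing L] [LieAlgebra ℂ L] [FiniteDimensional ℂ L]
    [LieAlgebra.IsKilling ℂ L]
    (h : LieSubalgebra ℂ L) [h.IsCartanSubalgebra] (α : Module.Dual ℂ ↥h) (x : L) :
    x ∈ rootSpace' h α ↔ x ∈ LieAlgebra.rootSpace h α := by
  constructor
  · intro hx
    apply LieModule.weightSpace_le_genWeightSpace
    rw [LieModule.mem_weightSpace]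
    exact hx
  · intro hx H
    exact LieAlgebra.IsKilling.lie_eq_smul_of_mem_rootSpace hx H

lemma absRoots_lie {L : Type*} [LieRing L] [LieAlgebra ℂ L] [FiniteDimensional ℂ L]
    [LieAlgebra.IsKilling ℂ L]
    (h : LieSubalgebra ℂ L) [h.IsCartanSubalgebra]
    (Φ : Set (Module.Dual ℂ ↥h)) (hΦ : Φ = {α | α ≠ 0 ∧ rootSpace' h α ≠ ⊥})
    (cor : Module.Dual ℂ ↥h → ↥h)
    (hcor2 : ∀ α ∈ Φ, α (cor α) = 2)
    (hcorEx : ∀ α ∈ Φ, ∃ x ∈ rootSpace' h α, ∃ y ∈ rootSpace' h (-α),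
      ⁅x, y⁆ = (cor α : L)) : AbsRoots Φ cor := by
  have hbot : ∀ α : Module.Dual ℂ ↥h, rootSpace' h α ≠ ⊥ ↔ LieAlgebra.rootSpace h α ≠ ⊥ := by
    intro α
    have : rootSpace' h α = (LieAlgebra.rootSpace h α).toSubmodule := by
      ext x; exact rootSpace'_eq h α x
    rw [this, Ne, LieSubmodule.toSubmodule_eq_bot]
  have h1 : ∀ α, α ∈ Φ ↔ ∃ i, (LieAlgebra.IsKilling.rootSystem h).root i = α := by
    intro α
    rw [hΦ]
    constructor
    · rintro ⟨h0, hne⟩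
      rw [hbot] at hne
      refine ⟨⟨⟨α, hne⟩, ?_⟩, ?_⟩
      · simp only [Finset.mem_filter, Finset.mem_univ, true_and]
        intro e
        apply h0
        ext x
        exact congrFun e x
      · ext x; rfl
    · rintro ⟨i, rfl⟩
      refine ⟨(LieAlgebra.IsKilling.rootSystem h).ne_zero i, ?_⟩
      rw [hbot]
      exact i.1.genWeightSpace_ne_bot
  refine absRoots_of_rootPairing (LieAlgebra.IsKilling.rootSystem h) (fun _ _ => rfl) Φ cor h1 ?_
  intro i
  have hi := (h1 _).2 ⟨i, rfl⟩
  obtain ⟨x, hx, y, hy, hxy⟩ := hcorEx _ hi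
  have h2 := hcor2 _ hi
  rw [rootSpace'_eq] at hx hy
  rw [LieAlgebra.IsKilling.rootSystem_root_apply] at hx hy hxy h2 ⊢
  rw [LieAlgebra.IsKilling.rootSystem_coroot_apply]
  generalize cor _ = z at hxy h2 ⊢
  have hmem : z ∈ LieAlgebra.corootSpace (i.1 : ↥h → ℂ) :=
    (LieAlgebra.mem_corootSpace _).2 (Submodule.subset_span ⟨x, hx, y, hy, hxy⟩)
  exact LieAlgebra.IsKilling.eq_coroot_of_mem_corootSpace_of_two i.1 hmem h2

lemma lie_mem_rootSpace' {L : Type*} [LieRing L] [LieAlgebra ℂ L]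
    (h : LieSubalgebra ℂ L) {α β : Module.Dual ℂ ↥h} {x y : L}
    (hx : x ∈ rootSpace' h α) (hy : y ∈ rootSpace' h β) : ⁅x, y⁆ ∈ rootSpace' h (α + β) := by
  intro H
  rw [leibniz_lie, hx H, hy H, smul_lie, lie_smul, LinearMap.add_apply, add_smul]

/-- For a Π-system `Sg` of the root system `Φ`, the sum
`H = Σ_{β ∈ R(Sg)₊} β∨` of the positive coroots of the subsystem with base `Sg`
is an `A₁`-vector: it completes to an `sl₂`-triple `(H, E₊, E₋)` with
`E₊ ∈ ⨁_{α ∈ Sg} L_α` and `E₋ ∈ ⨁_{α ∈ Sg} L_{−α}`. -/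
theorem sum_pos_coroots_is_A1_vector
    {L : Type*} [LieRing L] [LieAlgebra ℂ L] [FiniteDimensional ℂ L]
    [LieAlgebra.IsSemisimple ℂ L]
    (h : LieSubalgebra ℂ L) (hca : h.IsCartanSubalgebra)
    (Φ : Set (Module.Dual ℂ ↥h)) (hΦ : Φ = {α | α ≠ 0 ∧ rootSpace' h α ≠ ⊥})
    (cor : Module.Dual ℂ ↥h → ↥h)
    (hcor2 : ∀ α ∈ Φ, α (cor α) = 2)
    (hcorSpan : ∀ α ∈ Φ, ∀ x ∈ rootSpace' h α, ∀ y ∈ rootSpace' h (-α),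
      ∃ c : ℂ, ⁅x, y⁆ = c • ((cor α : L)))
    (hcorEx : ∀ α ∈ Φ, ∃ x ∈ rootSpace' h α, ∃ y ∈ rootSpace' h (-α),
      ⁅x, y⁆ = (cor α : L))
    (Sg : Set (Module.Dual ℂ ↥h)) (hSgΦ : Sg ⊆ Φ)
    (hSgli : LinearIndependent ℂ ((↑) : Sg → Module.Dual ℂ ↥h))
    (hSgpi : ∀ α ∈ Sg, ∀ β ∈ Sg, α - β ∉ Φ)
    (P : Finset (Module.Dual ℂ ↥h))
    (hP : ↑P = {β ∈ dualSubSystem cor Sg | DualNonnegCombo Sg β})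
    (H : ↥h) (hH : H = ∑ β ∈ P, cor β) :
    ∃ Ep ∈ (⨆ α ∈ Sg, rootSpace' h α), ∃ Em ∈ (⨆ α ∈ Sg, rootSpace' h (-α)),
      ⁅(H : L), Ep⁆ = (2 : ℂ) • Ep ∧
      ⁅(H : L), Em⁆ = (-2 : ℂ) • Em ∧
      ⁅Ep, Em⁆ = (H : L) := by
  classical
  have R : AbsRoots Φ cor := absRoots_lie h Φ hΦ cor hcor2 hcorEx
  have hlc : ∀ c : Module.Dual ℂ ↥h →₀ ℤ, lc c = c.sum (fun α n => n • α) := fun c => by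
    simp [lc, Finsupp.linearCombination_apply]
  -- invariants of the subsystem
  have hinv : ∀ x ∈ dualSubSystem cor Sg, x ∈ Φ ∧ cor x ∈ Submodule.span ℂ (cor '' Sg) := by
    rintro _ ⟨w, hw, α, hα, rfl⟩
    have key : ∀ x : Module.Dual ℂ ↥h, (x ∈ Φ ∧ cor x ∈ Submodule.span ℂ (cor '' Sg)) →
        (w x ∈ Φ ∧ cor (w x) ∈ Submodule.span ℂ (cor '' Sg)) := by
      induction hw using Submonoid.closure_induction with
      | mem w hw =>
        obtain ⟨β, hβ, rfl⟩ := hw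
        rintro x ⟨hx, hx'⟩
        have hs : sDual cor β x = x - x (cor β) • β := rfl
        rw [hs]
        refine ⟨R.refl_mem x hx β (hSgΦ hβ), ?_⟩
        rw [R.cor_refl x hx β (hSgΦ hβ)]
        exact Submodule.sub_mem _ hx' (Submodule.smul_mem _ _
          (Submodule.subset_span ⟨β, hβ, rfl⟩))
      | one => intro x hx; exact hx
      | mul a b _ _ ha hb => intro x hx; exact ha _ (hb x hx)
    exact key α ⟨hSgΦ hα, Submodule.subset_span ⟨α, hα, rfl⟩⟩
  have hP' : ∀ β, β ∈ P ↔ β ∈ dualSubSystem cor Sg ∧ DualNonnegCombo Sg β := by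
    intro β
    rw [← Finset.mem_coe, hP]; rfl
  have hpair : ∀ α ∈ Sg, α H = 2 := by
    intro α hα
    rw [hH]
    refine R.simple_pairing hSgΦ hSgli hSgpi P (dualSubSystem cor Sg) (fun x hx => (hinv x hx).1)
      ?_ ?_ ?_ hα
    · intro x hx
      exact ⟨1, Submonoid.one_mem _, x, hx, rfl⟩
    · rintro _ ⟨w, hw, γ, hγ, rfl⟩ β hβ
      exact ⟨sDual cor β * w, Submonoid.mul_mem _ (Submonoid.subset_closure ⟨β, hβ, rfl⟩) hw,
        γ, hγ, rfl⟩
    · intro β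
      rw [hP']
      refine and_congr_right fun _ => ?_
      constructor
      · rintro ⟨c, h1, h2, h3⟩
        exact ⟨c, h1, by rw [hlc, h2], h3⟩
      · rintro ⟨c, h1, h2, h3⟩
        exact ⟨c, h1, by rw [← hlc, h2], h3⟩
  have hspan : H ∈ Submodule.span ℂ (cor '' Sg) := by
    rw [hH]
    exact Submodule.sum_mem _ fun β hβ => (hinv β ((hP' β).1 hβ).1).2
  rw [Finsupp.mem_span_image_iff_linearCombination] at hspan
  obtain ⟨l, hl, hlH⟩ := hspan
  have hex : ∀ α : Module.Dual ℂ ↥h, ∃ e f : L, α ∈ Sg →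
      e ∈ rootSpace' h α ∧ f ∈ rootSpace' h (-α) ∧ ⁅e, f⁆ = (cor α : L) := by
    intro α
    by_cases hα : α ∈ Sg
    · obtain ⟨x, hx, y, hy, hxy⟩ := hcorEx α (hSgΦ hα)
      exact ⟨x, y, fun _ => ⟨hx, hy, hxy⟩⟩
    · exact ⟨0, 0, fun h' => absurd h' hα⟩
  choose e f hef using hex
  have hS : ∀ α ∈ l.support, α ∈ Sg := fun α hα => hl hα
  refine ⟨∑ α ∈ l.support, e α, ?_, ∑ α ∈ l.support, l α • f α, ?_, ?_, ?_, ?_⟩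
  · refine Submodule.sum_mem _ fun α hα => ?_
    exact Submodule.mem_iSup_of_mem α (Submodule.mem_iSup_of_mem (hS α hα) (hef α (hS α hα)).1)
  · refine Submodule.sum_mem _ fun α hα => Submodule.smul_mem _ _ ?_
    exact Submodule.mem_iSup_of_mem α (Submodule.mem_iSup_of_mem (hS α hα) (hef α (hS α hα)).2.1)
  · rw [lie_sum, Finset.smul_sum]
    refine Finset.sum_congr rfl fun α hα => ?_
    rw [(hef α (hS α hα)).1 H, hpair α (hS α hα)]
  · rw [lie_sum, Finset.smul_sum]
    refine Finset.sum_congr rfl fun α hα => ?_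
    rw [lie_smul, (hef α (hS α hα)).2.1 H, LinearMap.neg_apply, hpair α (hS α hα), smul_comm]
  · have hz : ∀ α ∈ Sg, ∀ β ∈ Sg, α ≠ β → ⁅e α, f β⁆ = 0 := by
      intro α hα β hβ hne
      have h1 := lie_mem_rootSpace' h (hef α hα).1 (hef β hβ).2.1
      rw [← sub_eq_add_neg] at h1
      have h2 := hSgpi α hα β hβ
      rw [hΦ] at h2
      have h3 : rootSpace' h (α - β) = ⊥ := by
        by_contra h3
        exact h2 ⟨sub_ne_zero.2 hne, h3⟩
      rw [h3] at h1
      simpa using h1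
    have hHL : (H : L) = ∑ α ∈ l.support, l α • (cor α : L) := by
      rw [← hlH, Finsupp.linearCombination_apply, Finsupp.sum]
      simp
    rw [hHL, lie_sum]
    refine Finset.sum_congr rfl fun β hβ => ?_
    rw [lie_smul, sum_lie, Finset.sum_eq_single β]
    · rw [(hef β (hS β hβ)).2.2]
    · intro α hα hne
      exact hz α (hS α hα) β (hS β hβ) hne
    · intro h'; exact absurd hβ h'
end

section
/- Let L be a finite-dimensional complex semisimple Lie algebra with Cartan subalgebra h, root system Φ ⊆ h*, base S, and positive roots Φ₊. Let (H, E₊, E₋) be an sl₂-triple with H ∈ h dominant regular (α(H) a positive real number for all α ∈ Φ₊), and set S(H) = {α ∈ Φ : α(H) = 2}. Then E₊ ∈ ⨁_{α ∈ S(H)} L_α and E₋ ∈ ⨁_{α ∈ S(H)} L_{−α}, and moreover for every α ∈ S(H) the component of E₊ in L_α is nonzero and the component of E₋ in L_{−α} is nonzero. -/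
section Aux

variable {L : Type*} [LieRing L] [LieAlgebra ℂ L] [FiniteDimensional ℂ L]

lemma aux_sl2_inj (H e f : L) (he : ⁅H, e⁆ = (2 : ℂ) • e)
    (hef : ⁅e, f⁆ = H) (v : L) (hv : ⁅H, v⁆ = (2 : ℂ) • v) (h0 : ⁅e, ⁅f, v⁆⁆ = 0) : v = 0 := by
  by_contra hne
  let w : ℕ → L := fun n => Nat.rec v (fun _ x => ⁅e, x⁆) n
  have w0 : w 0 = v := rfl
  have ws : ∀ n, w (n+1) = ⁅e, w n⁆ := fun n => rfl
  have hw : ∀ n : ℕ, ⁅H, w n⁆ = (2 + 2 * (n : ℂ)) • w n := by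
    intro n
    induction n with
    | zero => simpa [w0] using hv
    | succ n ih =>
      rw [ws, leibniz_lie, he, ih, lie_smul, smul_lie, ← add_smul]
      congr 1
      push_cast
      ring
  have hf : ∀ n : ℕ, ⁅e, ⁅f, w n⁆⁆ = (-((n : ℂ) * (n + 1))) • w n := by
    intro n
    induction n with
    | zero => simpa [w0] using h0
    | succ n ih =>
      have h1 : ⁅f, w (n+1)⁆ = (-(((n:ℂ)+1) * (n + 2))) • w n := by
        have h2 : ⁅f, ⁅e, w n⁆⁆ = ⁅e, ⁅f, w n⁆⁆ - ⁅H, w n⁆ := by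
          rw [← hef, lie_lie]; abel
        rw [ws, h2, ih, hw, ← sub_smul]
        congr 1
        ring
      rw [h1, lie_smul, ← ws]
      congr 1
      push_cast
      ring
  have hwne : ∀ n, w n ≠ 0 := by
    intro n
    induction n with
    | zero => exact hne
    | succ n ih =>
      intro h
      have h2 : ⁅f, ⁅e, w n⁆⁆ = ⁅e, ⁅f, w n⁆⁆ - ⁅H, w n⁆ := by
        rw [← hef, lie_lie]; abel
      rw [← ws, h, lie_zero, hf, hw, ← sub_smul] at h2
      rcases smul_eq_zero.mp h2.symm with h3 | h3
      · have h4 : (((n + 1) * (n + 2) : ℕ) : ℂ) = 0 := by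
          push_cast
          linear_combination -h3
        rw [Nat.cast_eq_zero] at h4
        simp at h4
      · exact ih h3
  have hfin := Module.End.finite_hasEigenvalue (LieAlgebra.ad ℂ L H)
  have hinj : Function.Injective (fun n : ℕ => (2 + 2 * (n : ℂ))) := by
    intro a b hab
    simpa using hab
  refine Set.infinite_range_of_injective hinj (hfin.subset ?_)
  rintro _ ⟨n, rfl⟩
  exact Module.End.hasEigenvalue_of_hasEigenvector (x := w n)
    ⟨Module.End.mem_eigenspace_iff.mpr (by simpa using hw n), hwne n⟩

lemma aux_sl2_surj (H e f : L) (he : ⁅H, e⁆ = (2 : ℂ) • e) (hf : ⁅H, f⁆ = (-2 : ℂ) • f)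
    (hef : ⁅e, f⁆ = H) (y : L) (hy : ⁅H, y⁆ = (2 : ℂ) • y) :
    ∃ z, ⁅H, z⁆ = 0 ∧ ⁅e, z⁆ = y := by
  let V := Module.End.eigenspace (LieAlgebra.ad ℂ L H) 2
  have memV : ∀ x, x ∈ V ↔ ⁅H, x⁆ = (2 : ℂ) • x := fun x => by
    simp [V]
  have hfv : ∀ v ∈ V, ⁅H, ⁅f, v⁆⁆ = 0 := by
    intro v hv
    rw [memV] at hv
    rw [leibniz_lie, hf, hv, lie_smul, smul_lie, ← add_smul]
    simp
  let T : L →ₗ[ℂ] L := (LieAlgebra.ad ℂ L e) ∘ₗ (LieAlgebra.ad ℂ L f)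
  have hT : ∀ v ∈ V, T v ∈ V := by
    intro v hv
    rw [memV]
    change ⁅H, ⁅e, ⁅f, v⁆⁆⁆ = (2 : ℂ) • ⁅e, ⁅f, v⁆⁆
    rw [leibniz_lie, hfv v hv, he, smul_lie, lie_zero, add_zero]
  have hinj : Function.Injective (T.restrict hT) := by
    rw [injective_iff_map_eq_zero]
    intro v hv
    apply Subtype.ext
    exact aux_sl2_inj H e f he hef v ((memV _).mp v.2) (congrArg Subtype.val hv)
  obtain ⟨v, hv⟩ := LinearMap.surjective_of_injective hinj ⟨y, (memV y).mpr hy⟩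
  exact ⟨⁅f, (v : L)⁆, hfv v v.2, congrArg Subtype.val hv⟩

variable [LieAlgebra.IsSemisimple ℂ L] (h : LieSubalgebra ℂ L) [h.IsCartanSubalgebra]

lemma aux_mem_iff (α : Module.Dual ℂ h) (x : L) :
    x ∈ rootSpace' h α ↔ x ∈ LieAlgebra.rootSpace h α := by
  constructor
  · intro hx
    apply LieModule.weightSpace_le_genWeightSpace
    rw [LieModule.mem_weightSpace]
    exact hx
  · intro hx H
    exact LieAlgebra.IsKilling.lie_eq_smul_of_mem_rootSpace hx H

lemma aux_eq (α : Module.Dual ℂ h) :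
    rootSpace' h α = (LieAlgebra.rootSpace h α).toSubmodule := by
  ext x
  exact aux_mem_iff h α x

lemma aux_neg (α : Module.Dual ℂ h) (hα : rootSpace' h α ≠ ⊥) : rootSpace' h (-α) ≠ ⊥ := by
  rw [aux_eq] at hα ⊢
  let w : LieModule.Weight ℂ h L := ⟨α, by simpa using hα⟩
  have := (-w).genWeightSpace_ne_bot
  intro hb
  apply this
  rw [← LieSubmodule.toSubmodule_eq_bot]
  exact hb

lemma aux_indep : iSupIndep (rootSpace' h) := by
  have h1 := LieModule.iSupIndep_genWeightSpace ℂ h L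
  rw [← LieSubmodule.iSupIndep_toSubmodule] at h1
  have h2 := h1.comp (f := fun α : Module.Dual ℂ h => (α : h → ℂ)) DFunLike.coe_injective
  convert h2 using 1
  ext1 α
  exact aux_eq h α

lemma aux_top : ⨆ α, rootSpace' h α = ⊤ := by
  have h1 := LieModule.iSup_genWeightSpace_eq_top' ℂ h L
  rw [← LieSubmodule.toSubmodule_inj, LieSubmodule.iSup_toSubmodule,
    LieSubmodule.top_toSubmodule] at h1
  rw [eq_top_iff, ← h1]
  refine iSup_le fun w => ?_
  refine le_iSup_of_le w.toLinear ?_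
  rw [aux_eq]
  rfl

lemma aux_zero (x : L) (hx : x ∈ rootSpace' h 0) : x ∈ h := by
  rw [aux_mem_iff] at hx
  have := LieAlgebra.rootSpace_zero_eq ℂ L h
  change x ∈ LieAlgebra.rootSpace h (0 : h → ℂ) at hx
  rw [this] at hx
  simpa using hx

lemma aux_sum {F : Finset (Module.Dual ℂ h)} {g : Module.Dual ℂ h → L}
    (hg : ∀ α ∈ F, g α ∈ rootSpace' h α) (hs : ∑ α ∈ F, g α = 0) : ∀ α ∈ F, g α = 0 :=
  (iSupIndep_iff_finsetSum_eq_zero_imp_eq_zero _).mp (aux_indep h) F g hg hs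

lemma aux_eigen (H : h) (c : ℂ) (x : L) (hx : ⁅(H : L), x⁆ = c • x) :
    ∃ g : Module.Dual ℂ h →₀ L, (∀ α, g α ∈ rootSpace' h α) ∧
      (∑ α ∈ g.support, g α = x) ∧ ∀ α ∈ g.support, α H = c := by
  have hm : x ∈ ⨆ α, rootSpace' h α := by rw [aux_top]; trivial
  obtain ⟨g, hg, hs⟩ := (Submodule.mem_iSup_iff_exists_finsupp _ _).mp hm
  change ∑ α ∈ g.support, g α = x at hs
  refine ⟨g, hg, hs, ?_⟩
  have h0 : ∑ α ∈ g.support, (α H - c) • g α = 0 := by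
    rw [← hs, lie_sum, Finset.smul_sum, ← sub_eq_zero, ← Finset.sum_sub_distrib] at hx
    rw [← hx]
    refine Finset.sum_congr rfl fun α _ => ?_
    rw [hg α H, sub_smul]
  intro α hα
  have := aux_sum h (fun α _ => Submodule.smul_mem _ _ (hg α)) h0 α hα
  rcases smul_eq_zero.mp this with h1 | h1
  · exact sub_eq_zero.mp h1
  · exact absurd h1 (Finsupp.mem_support_iff.mp hα)

lemma aux_mem_sup (H : h) (c : ℂ) (hc : c ≠ 0) (x : L) (hx : ⁅(H : L), x⁆ = c • x) :
    x ∈ ⨆ α ∈ {α : Module.Dual ℂ h | (α ≠ 0 ∧ rootSpace' h α ≠ ⊥) ∧ α H = c},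
      rootSpace' h α := by
  obtain ⟨g, hg, hs, hsupp⟩ := aux_eigen h H c x hx
  rw [← hs]
  refine Submodule.sum_mem _ fun α hα => ?_
  refine Submodule.mem_iSup_of_mem α (Submodule.mem_iSup_of_mem ?_ (hg α))
  refine ⟨⟨?_, ?_⟩, hsupp α hα⟩
  · rintro rfl
    exact hc (by simpa using (hsupp 0 hα).symm)
  · intro hb
    have := hg α
    rw [hb, Submodule.mem_bot] at this
    exact (Finsupp.mem_support_iff.mp hα) this

lemma aux_mem_cartan (H : h) (hreg : ∀ α : Module.Dual ℂ h, α ≠ 0 → rootSpace' h α ≠ ⊥ → α H ≠ 0)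
    (x : L) (hx : ⁅(H : L), x⁆ = 0) : x ∈ h := by
  obtain ⟨g, hg, hs, hsupp⟩ := aux_eigen h H 0 x (by simpa using hx)
  rw [← hs]
  refine sum_mem fun α hα => ?_
  by_cases h0 : α = 0
  · exact aux_zero h _ (h0 ▸ hg α)
  · refine absurd (hsupp α hα) (hreg α h0 ?_)
    intro hb
    have := hg α
    rw [hb, Submodule.mem_bot] at this
    exact (Finsupp.mem_support_iff.mp hα) this

lemma aux_nonzero (H : h)
    (hreg : ∀ α : Module.Dual ℂ h, α ≠ 0 → rootSpace' h α ≠ ⊥ → α H ≠ 0) (c : ℂ) (E : L)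
    (hsurj : ∀ y : L, ⁅(H : L), y⁆ = c • y → ∃ z : L, ⁅(H : L), z⁆ = 0 ∧ ⁅E, z⁆ = y)
    (Q : Finset (Module.Dual ℂ h)) (hQ : ∀ α ∈ Q, rootSpace' h α ≠ ⊥ ∧ α H = c)
    (e : Module.Dual ℂ h → L) (he : ∀ α ∈ Q, e α ∈ rootSpace' h α)
    (hE : E = ∑ α ∈ Q, e α) : ∀ α ∈ Q, e α ≠ 0 := by
  classical
  intro β hβ h0
  obtain ⟨y, hy, hy0⟩ := (Submodule.ne_bot_iff _).mp (hQ β hβ).1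
  obtain ⟨z, hz, hzy⟩ := hsurj y (by rw [hy H, (hQ β hβ).2])
  have hzh := aux_mem_cartan h H hreg z hz
  let Z : h := ⟨z, hzh⟩
  have h1 : y = ∑ α ∈ Q, -(α Z) • e α := by
    rw [← hzy, hE, sum_lie]
    refine Finset.sum_congr rfl fun α hα => ?_
    rw [← lie_skew, neg_smul]
    exact congrArg Neg.neg (he α hα Z)
  have h2 : ∑ α ∈ Q, ((if α = β then y else 0) + (α Z) • e α) = 0 := by
    rw [Finset.sum_add_distrib, Finset.sum_ite_eq' Q β, if_pos hβ, h1, ← Finset.sum_add_distrib]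
    exact Finset.sum_eq_zero fun α _ => by simp
  have h3 := aux_sum h (fun α hα => ?_) h2 β hβ
  · rw [if_pos rfl, h0, smul_zero, add_zero] at h3
    exact hy0 h3
  · refine Submodule.add_mem _ ?_ (Submodule.smul_mem _ _ (he α hα))
    split_ifs with hh
    · exact hh ▸ hy
    · exact Submodule.zero_mem _

end Aux

/-- If `(H, E₊, E₋)` is an `sl₂`-triple with `H ∈ h` dominant regular, then
`E₊ ∈ ⨁_{α ∈ S(H)} L_α` and `E₋ ∈ ⨁_{α ∈ S(H)} L_{−α}` where
`S(H) = {α ∈ Φ : α(H) = 2}`, and each component of `E₊` (resp. `E₋`) in `L_α`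
(resp. `L_{−α}`), `α ∈ S(H)`, is nonzero. -/
theorem sl2_Ep_Em_components_nonzero
    {L : Type*} [LieRing L] [LieAlgebra ℂ L] [FiniteDimensional ℂ L]
    [LieAlgebra.IsSemisimple ℂ L]
    (h : LieSubalgebra ℂ L) (hca : h.IsCartanSubalgebra)
    (Φ : Set (Module.Dual ℂ ↥h)) (hΦ : Φ = {α | α ≠ 0 ∧ rootSpace' h α ≠ ⊥})
    (S : Set (Module.Dual ℂ ↥h)) (hS : DualIsBase Φ S)
    (H : ↥h) (Ep Em : L)
    (hEp : ⁅(H : L), Ep⁆ = (2 : ℂ) • Ep)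
    (hEm : ⁅(H : L), Em⁆ = (-2 : ℂ) • Em)
    (hPM : ⁅Ep, Em⁆ = (H : L))
    (hreg : ∀ α ∈ Φ, DualNonnegCombo S α → ∃ t : ℝ, 0 < t ∧ α H = (t : ℂ)) :
    Ep ∈ (⨆ α ∈ {α ∈ Φ | α H = 2}, rootSpace' h α) ∧
    Em ∈ (⨆ α ∈ {α ∈ Φ | α H = 2}, rootSpace' h (-α)) ∧
    ∀ P : Finset (Module.Dual ℂ ↥h), ↑P = {α ∈ Φ | α H = 2} →
      (∃ e : Module.Dual ℂ ↥h → L,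
        (∀ α ∈ P, e α ∈ rootSpace' h α ∧ e α ≠ 0) ∧ Ep = ∑ α ∈ P, e α) ∧
      (∃ f : Module.Dual ℂ ↥h → L,
        (∀ α ∈ P, f α ∈ rootSpace' h (-α) ∧ f α ≠ 0) ∧ Em = ∑ α ∈ P, f α) := by
  classical
  have _i := hca
  have hΦneg : ∀ α ∈ Φ, -α ∈ Φ := by
    intro α hα
    rw [hΦ] at hα ⊢
    exact ⟨neg_ne_zero.mpr hα.1, aux_neg h α hα.2⟩
  have hreg' : ∀ α : Module.Dual ℂ ↥h, α ≠ 0 → rootSpace' h α ≠ ⊥ → α H ≠ 0 := by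
    intro α h0 h1
    have hα : α ∈ Φ := by rw [hΦ]; exact ⟨h0, h1⟩
    obtain ⟨c, hc, hsum, hpos | hneg⟩ := hS.2 α hα
    · obtain ⟨t, ht, hHt⟩ := hreg α hα ⟨c, hc, hsum, hpos⟩
      rw [hHt]
      exact_mod_cast ht.ne'
    · obtain ⟨t, ht, hHt⟩ := hreg (-α) (hΦneg α hα) ⟨-c, by simpa using hc, by
        rw [hsum, Finsupp.sum_neg_index (by simp), Finsupp.sum, Finsupp.sum,
          ← Finset.sum_neg_distrib]
        exact Finset.sum_congr rfl fun _ _ => by simp, fun β => by simpa using hneg β⟩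
      intro h2
      rw [LinearMap.neg_apply, h2, neg_zero] at hHt
      exact ht.ne (by exact_mod_cast hHt)
  have hEp1 : Ep ∈ (⨆ α ∈ {α ∈ Φ | α H = 2}, rootSpace' h α) := by
    have := aux_mem_sup h H 2 (by norm_num) Ep hEp
    subst hΦ
    exact this
  have hEm1 : Em ∈ (⨆ α ∈ {α ∈ Φ | α H = 2}, rootSpace' h (-α)) := by
    have := aux_mem_sup h H (-2) (by norm_num) Em hEm
    refine (iSup₂_le ?_ : _ ≤ (⨆ α ∈ {α ∈ Φ | α H = 2}, rootSpace' h (-α))) this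
    intro α hα
    have hα' : -α ∈ {α ∈ Φ | α H = 2} :=
      ⟨hΦneg α (by rw [hΦ]; exact hα.1), by simp [hα.2]⟩
    refine le_iSup₂_of_le (-α) hα' ?_
    rw [neg_neg]
  refine ⟨hEp1, hEm1, fun P hP => ?_⟩
  have hmem : ∀ α, α ∈ P ↔ α ∈ {α ∈ Φ | α H = 2} := fun α => by
    rw [← hP, Finset.mem_coe]
  have hbot : ∀ α ∈ P, rootSpace' h α ≠ ⊥ := fun α hα => by
    have := ((hmem α).mp hα).1
    rw [hΦ] at this
    exact this.2
  simp only [← hmem] at hEp1 hEm1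
  constructor
  · obtain ⟨e, he⟩ := (Submodule.mem_iSup_finset_iff_exists_sum _ _).mp hEp1
    refine ⟨fun α => e α, fun α hα => ⟨(e α).2, ?_⟩, he.symm⟩
    exact aux_nonzero h H hreg' 2 Ep (aux_sl2_surj (H : L) Ep Em hEp hEm hPM) P
      (fun α hα => ⟨hbot α hα, ((hmem α).mp hα).2⟩) (fun α => e α) (fun α _ => (e α).2)
      he.symm α hα
  · obtain ⟨f, hfm, hf⟩ : ∃ f : Module.Dual ℂ ↥h → L, (∀ α, f α ∈ rootSpace' h (-α)) ∧
        ∑ α ∈ P, f α = Em := by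
      obtain ⟨f, hf⟩ := (Submodule.mem_iSup_finset_iff_exists_sum _ _).mp hEm1
      exact ⟨fun α => f α, fun α => (f α).2, hf⟩
    refine ⟨f, fun α hα => ⟨hfm α, ?_⟩, hf.symm⟩
    have hsurj : ∀ y : L, ⁅(H : L), y⁆ = (-2 : ℂ) • y → ∃ z : L, ⁅(H : L), z⁆ = 0 ∧ ⁅Em, z⁆ = y := by
      intro y hy
      obtain ⟨z, hz, hzy⟩ := aux_sl2_surj (-(H : L)) Em Ep (by rw [neg_lie, hEm]; simp)
        (by rw [neg_lie, hEp]; simp) (by rw [← lie_skew, hPM]) y (by rw [neg_lie, hy]; simp)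
      exact ⟨z, by rwa [neg_lie, neg_eq_zero] at hz, hzy⟩
    have key := aux_nonzero h H hreg' (-2) Em hsurj (P.image (fun α => -α)) (by
        intro α hα
        obtain ⟨β, hβ, rfl⟩ := Finset.mem_image.mp hα
        exact ⟨aux_neg h β (hbot β hβ), by simp [((hmem β).mp hβ).2]⟩)
      (fun α => f (-α)) (by
        intro α hα
        have := hfm (-α)
        rwa [neg_neg] at this) (by
        rw [Finset.sum_image (fun a _ b _ hab => neg_injective hab)]
        simp only [neg_neg]
        exact hf.symm) (-α) (Finset.mem_image_of_mem _ hα)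
    simpa only [neg_neg] using key
end
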